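/- Minkowski's second theorem specialization: if Π is a 0-symmetric parallelepiped in ℝ^d (image of [-1,1]^d under an invertible linear map) and μ_k denotes the k-th successive minimum with respect to ℤ^d, then 2^d/(d!·vol Π) ≤ Π_{i=1}^d μ_i(Π, ℤ^d) ≤ 2^d / vol Π. -/

import Mathlib

open MeasureTheory
open scoped BigOperators Pointwise

/-- The `k`-th successive minimum of a symmetric convex body `M ⊆ ℝ^d` with
respect to the lattice `ℤ^d`: the infimum of `μ > 0` such that `μM` contains
`k` linearly independent integer points. -/
noncomputable def succMin {d : ℕ} (k : ℕ) (M : Set (Fin d → ℝ)) : ℝ :=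
  sInf {μ : ℝ | 0 < μ ∧ ∃ w : Fin k → (Fin d → ℤ),
    LinearIndependent ℝ (fun i => fun j => ((w i j : ℝ))) ∧
    ∀ i, (fun j => ((w i j : ℝ))) ∈ μ • M}

/-- A measurable injectivity form of Blichfeldt's principle: a piecewise affine map with constant
linear part `T` and countably many measurable pieces which is injective modulo `ℤ^d` on `S` forces
`|det T| * vol S ≤ 1`. -/
theorem ofReal_abs_det_mul_volume_le_one {d : ℕ} {κ : Type*} [Countable κ] [MeasurableSpace κ]
    [MeasurableSingletonClass κ] (T : (Fin d → ℝ) →ₗ[ℝ] (Fin d → ℝ)) (hT : LinearMap.det T ≠ 0)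
    {k : (Fin d → ℝ) → κ} (hk : Measurable k) (C : κ → Fin d → ℝ) {S : Set (Fin d → ℝ)}
    (hS : MeasurableSet S)
    (hinj : ∀ x ∈ S, ∀ y ∈ S, x ≠ y → ∀ z : Fin d → ℤ,
      T x + C (k x) - (T y + C (k y)) ≠ fun j => (z j : ℝ)) :
    ENNReal.ofReal |LinearMap.det T| * volume S ≤ 1 := by
  have hTm : Measurable T := T.continuous_of_finiteDimensional.measurable
  have hTinj : Function.Injective T := (LinearMap.equivOfDetNeZero T hT).injective
  have hTemb : MeasurableEmbedding T :=
    (LinearMap.isClosedEmbedding_of_injective (LinearMap.ker_eq_bot.2 hTinj)).measurableEmbedding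
  let P : κ × (Fin d → ℤ) → Set (Fin d → ℝ) := fun q =>
    S ∩ {x | k x = q.1 ∧ ∀ i, ⌊T x i + C q.1 i⌋ = q.2 i}
  let I : κ × (Fin d → ℤ) → Set (Fin d → ℝ) := fun q =>
    (fun x => x + (C q.1 - fun j => (q.2 j : ℝ))) '' (T '' P q)
  have hP : ∀ q, MeasurableSet (P q) := by
    intro q
    have hfl : MeasurableSet {x | ∀ i, ⌊T x i + C q.1 i⌋ = q.2 i} := by
      rw [Set.ofPred_forall]
      refine MeasurableSet.iInter fun i => ?_
      have : Measurable fun x => ⌊T x i + C q.1 i⌋ :=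
        (((measurable_pi_apply i).comp hTm).add_const _).floor
      exact this (measurableSet_singleton (q.2 i))
    exact hS.inter ((hk (measurableSet_singleton q.1)).inter hfl)
  have hI : ∀ q, MeasurableSet (I q) := fun q =>
    (measurableEmbedding_addRight _).measurableSet_image.2 (hTemb.measurableSet_image.2 (hP q))
  have hvol : ∀ q, volume (I q) = ENNReal.ofReal |LinearMap.det T| * volume (P q) := by
    intro q
    rw [← Measure.addHaar_image_linearMap]
    simp only [I, Set.image_add_right, measure_preimage_add_right]
  have hPd : Pairwise (Function.onFun Disjoint P) := by
    intro q r hqr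
    refine Set.disjoint_left.2 fun x hx hx' => hqr ?_
    obtain ⟨-, h1, h2⟩ := hx
    obtain ⟨-, h3, h4⟩ := hx'
    have h5 : q.1 = r.1 := h1.symm.trans h3
    refine Prod.ext h5 (funext fun i => ?_)
    rw [← h2, ← h4, h5]
  have hId : Pairwise (Function.onFun Disjoint I) := by
    intro q r hqr
    refine Set.disjoint_left.2 ?_
    rintro _ ⟨_, ⟨x, hx, rfl⟩, rfl⟩ ⟨_, ⟨y, hy, rfl⟩, h⟩
    by_cases hxy : x = y
    · subst hxy
      exact Set.disjoint_left.1 (hPd hqr) hx hy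
    · refine hinj x hx.1 y hy.1 hxy (q.2 - r.2) ?_
      rw [hx.2.1, hy.2.1]
      funext j
      have := congrFun h j
      simp only [Pi.add_apply, Pi.sub_apply] at this ⊢
      push_cast
      linarith
  have hPS : S = ⋃ q, P q := by
    refine Set.Subset.antisymm (fun x hx => Set.mem_iUnion.2
      ⟨(k x, fun i => ⌊T x i + C (k x) i⌋), hx, rfl, fun _ => rfl⟩)
      (Set.iUnion_subset fun q => Set.inter_subset_left)
  have hsub : (⋃ q, I q) ⊆ Set.Icc 0 1 := by
    refine Set.iUnion_subset fun q => ?_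
    rintro _ ⟨_, ⟨x, hx, rfl⟩, rfl⟩
    have key : ∀ i, T x i + (C q.1 i - (q.2 i : ℝ)) = Int.fract (T x i + C q.1 i) := by
      intro i
      rw [← hx.2.2 i, Int.fract]
      ring
    refine ⟨fun i => ?_, fun i => ?_⟩
    · simp only [Pi.add_apply, Pi.sub_apply, key]
      exact Int.fract_nonneg _
    · simp only [Pi.add_apply, Pi.sub_apply, key]
      exact (Int.fract_lt_one _).le
  calc ENNReal.ofReal |LinearMap.det T| * volume S
      = ∑' q, ENNReal.ofReal |LinearMap.det T| * volume (P q) := by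
        conv_lhs => rw [hPS, measure_iUnion hPd hP]
        rw [ENNReal.tsum_mul_left]
    _ = volume (⋃ q, I q) := by
        rw [measure_iUnion hId hI]
        exact tsum_congr fun q => (hvol q).symm
    _ ≤ volume (Set.Icc (0 : Fin d → ℝ) 1) := measure_mono hsub
    _ = 1 := by simp [Real.volume_Icc_pi]

/-- An open set `U` admits a measurable selection, with countably many values, of a translation
along the subspace `L` moving points of `U + L` back into `U`. -/
theorem exists_measurable_translation_mem {d : ℕ} (L : Submodule ℝ (Fin d → ℝ))
    {U : Set (Fin d → ℝ)} (hU : IsOpen U) :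
    ∃ (v : ℕ → Fin d → ℝ) (k : (Fin d → ℝ) → ℕ), (∀ n, v n ∈ L) ∧ Measurable k ∧
      ∀ y, (∃ w ∈ L, y + w ∈ U) → y + v (k y) ∈ U := by
  classical
  let v : ℕ → L := TopologicalSpace.denseSeq L
  have hex : ∀ y : Fin d → ℝ, ∃ n, y + v n ∈ U ∨ ∀ m, y + v m ∉ U := by
    intro y
    by_cases h : ∃ n, y + v n ∈ U
    · exact h.imp fun _ => Or.inl
    · exact ⟨0, Or.inr (not_exists.1 h)⟩
  have hm : ∀ n, MeasurableSet {y : Fin d → ℝ | y + (v n : Fin d → ℝ) ∈ U} := fun n =>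
    (hU.preimage (continuous_add_const _)).measurableSet
  refine ⟨fun n => v n, fun y => Nat.find (hex y), fun n => (v n).2, ?_, ?_⟩
  · have hnone : MeasurableSet {y : Fin d → ℝ | ∀ m, y + (v m : Fin d → ℝ) ∉ U} := by
      rw [Set.ofPred_forall]
      exact MeasurableSet.iInter fun m => (hm m).compl
    exact measurable_find _ fun n => (hm n).union hnone
  · rintro y ⟨w, hw, hyw⟩
    have hopen : IsOpen {u : L | y + (u : Fin d → ℝ) ∈ U} :=
      hU.preimage ((continuous_const_add y).comp continuous_subtype_val)
    obtain ⟨n, hn⟩ := (TopologicalSpace.denseRange_denseSeq L).exists_mem_open hopen ⟨⟨w, hw⟩, hyw⟩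
    exact (Nat.find_spec (hex y)).resolve_right fun h => h n hn

/-- A nonnegative nondecreasing finite sequence is a sequence of partial sums of nonnegative
terms. -/
theorem Monotone.exists_sum_Iic_eq {d : ℕ} {ν : Fin d → ℝ} (hmono : Monotone ν)
    (hν : ∀ i, 0 ≤ ν i) : ∃ δ : Fin d → ℝ, (∀ i, 0 ≤ δ i) ∧ ∀ i, ∑ j ∈ Finset.Iic i, δ j = ν i := by
  cases d with
  | zero => exact ⟨ν, hν, fun i => i.elim0⟩
  | succ n =>
    refine ⟨Fin.cons (ν 0) fun j => ν j.succ - ν j.castSucc, fun i => ?_, fun i => ?_⟩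
    · refine Fin.cases (hν 0) (fun j => ?_) i
      simpa using hmono (Fin.castSucc_le_succ j)
    · induction i using Fin.induction with
      | zero =>
        have : Finset.Iic (0 : Fin (n + 1)) = {0} := by ext; simp
        simp [this]
      | succ j ih =>
        have h : Finset.Iic j.succ = insert j.succ (Finset.Iic j.castSucc) := by
          ext a
          simp only [Finset.mem_Iic, Finset.mem_insert, Fin.le_def, Fin.ext_iff, Fin.val_succ,
            Fin.val_castSucc]
          omega
        rw [h, Finset.sum_insert (by simp [Fin.le_def]), ih]
        simp

theorem Module.Basis.repr_toLin_diagonal_apply {ι R M : Type*} [Fintype ι] [DecidableEq ι]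
    [CommRing R] [AddCommGroup M] [Module R M] (b : Module.Basis ι R M) (w : ι → R) (x : M)
    (j : ι) : b.repr (Matrix.toLin b b (Matrix.diagonal w) x) j = w j * b.repr x j := by
  rw [Matrix.repr_toLin, Matrix.mulVec_diagonal]

theorem Module.Basis.mem_span_image_Iio {d : ℕ} {R M : Type*} [Ring R] [AddCommGroup M]
    [Module R M] (b : Module.Basis (Fin d) R M) (i : Fin d) (x : M) :
    x ∈ Submodule.span R (b '' Set.Iio i) ↔ ∀ j, i ≤ j → b.repr x j = 0 := by
  rw [b.mem_span_image]
  refine ⟨fun h j hij => ?_, fun h j hj => ?_⟩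
  · by_contra hne
    exact absurd (h (Finsupp.mem_support_iff.2 hne)) (not_lt.2 hij)
  · by_contra hne
    exact Finsupp.mem_support_iff.1 hj (h j (not_lt.1 hne))

/-- The upper bound in Minkowski's second theorem: if all integer points outside the span of the
first `i` basis vectors have seminorm at least `ν i`, then an open set of `p`-diameter less than one
has volume at most `(∏ ν i)⁻¹`. -/
theorem ofReal_prod_mul_volume_le_one {d : ℕ} (p : Seminorm ℝ (Fin d → ℝ))
    (b : Module.Basis (Fin d) ℝ (Fin d → ℝ)) {ν : Fin d → ℝ} (hmono : Monotone ν)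
    (hpos : ∀ i, 0 < ν i)
    (hmin : ∀ i, ∀ z : Fin d → ℤ, (fun j => (z j : ℝ)) ∉ Submodule.span ℝ (b '' Set.Iio i) →
      ν i ≤ p fun j => (z j : ℝ))
    {S : Set (Fin d → ℝ)} (hS : IsOpen S) (hdiam : ∀ x ∈ S, ∀ y ∈ S, p (x - y) < 1) :
    ENNReal.ofReal (∏ i, ν i) * volume S ≤ 1 := by
  obtain ⟨δ, hδ, hsum⟩ := hmono.exists_sum_Iic_eq fun i => (hpos i).le
  let L : Fin d → Submodule ℝ (Fin d → ℝ) := fun i => Submodule.span ℝ (b '' Set.Iio i)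
  let T := Matrix.toLin b b (Matrix.diagonal ν)
  let π : Fin d → (Fin d → ℝ) →ₗ[ℝ] (Fin d → ℝ) := fun i =>
    Matrix.toLin b b (Matrix.diagonal fun j => if i ≤ j then 1 else 0)
  have hπ : ∀ i x j, b.repr (π i x) j = if i ≤ j then b.repr x j else 0 := by
    intro i x j
    simp [π, b.repr_toLin_diagonal_apply]
  have hT : ∀ x, T x = ∑ i, δ i • π i x := by
    refine fun x => b.ext_elem fun j => ?_
    simp only [T, b.repr_toLin_diagonal_apply, ← hsum, map_sum, map_smul, Finsupp.coe_finsetSum,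
      Finset.sum_apply, Finsupp.smul_apply, hπ, smul_eq_mul, mul_ite, mul_zero,
      ← Finset.sum_filter, Finset.sum_mul]
    exact Finset.sum_congr (by ext; simp) fun _ _ => rfl
  choose v k hv hk hkS using fun i => exists_measurable_translation_mem (L i) hS
  let g : Fin d → (Fin d → ℝ) → (Fin d → ℝ) := fun i x => π i x + v i (k i (π i x))
  have hgS : ∀ i, ∀ x ∈ S, g i x ∈ S := by
    refine fun i x hx => hkS i _ ⟨x - π i x, ?_, by simpa using hx⟩
    rw [b.mem_span_image_Iio]
    intro j hij
    simp [hπ, hij]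
  have hdet : LinearMap.det T = ∏ i, ν i := by
    rw [LinearMap.det_toLin, Matrix.det_diagonal]
  have hprod : 0 < ∏ i, ν i := Finset.prod_pos fun i _ => hpos i
  have hK : Measurable fun x => fun i => k i (π i x) :=
    measurable_pi_lambda _ fun i =>
      (hk i).comp (π i).continuous_of_finiteDimensional.measurable
  have hφ : ∀ x, T x + ∑ i, δ i • v i (k i (π i x)) = ∑ i, δ i • g i x := by
    intro x
    simp only [hT, g, smul_add, Finset.sum_add_distrib]
  have main := ofReal_abs_det_mul_volume_le_one T (hdet ▸ hprod.ne') hK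
    (fun n => ∑ i, δ i • v i (n i)) hS.measurableSet ?_
  · rwa [hdet, abs_of_pos hprod] at main
  intro x hx y hy hxy z hz
  rw [hφ, hφ, ← Finset.sum_sub_distrib] at hz
  simp only [← smul_sub] at hz
  have hne : (Finset.univ.filter fun j => b.repr x j ≠ b.repr y j).Nonempty := by
    by_contra h
    refine hxy (b.ext_elem fun j => ?_)
    by_contra hj
    exact h ⟨j, by simpa using hj⟩
  obtain ⟨i, hi, himax⟩ := Finset.exists_max_image _ id hne
  have hi' : b.repr x i ≠ b.repr y i := (Finset.mem_filter.1 hi).2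
  have heq : ∀ j, i < j → b.repr x j = b.repr y j := by
    intro j hj
    by_contra h
    exact absurd (himax j (by simpa using h)) (not_le.2 hj)
  have hgeq : ∀ j, i < j → g j x = g j y := by
    intro j hj
    have : π j x = π j y := by
      refine b.ext_elem fun l => ?_
      rw [hπ, hπ]
      split_ifs with h
      · exact heq l (hj.trans_le h)
      · rfl
    simp only [g, this]
  have hz' : (∑ j ∈ Finset.Iic i, δ j • (g j x - g j y)) = fun j => (z j : ℝ) := by
    rw [← hz]
    refine Finset.sum_subset (Finset.subset_univ _) fun j _ hj => ?_
    rw [hgeq j (by simpa using hj), sub_self, smul_zero]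
  have hcoord : b.repr (fun j => (z j : ℝ)) i = ν i * (b.repr x i - b.repr y i) := by
    rw [← hz', ← hsum, Finset.sum_mul, map_sum, Finsupp.coe_finsetSum, Finset.sum_apply]
    refine Finset.sum_congr rfl fun j hj => ?_
    have hji : j ≤ i := Finset.mem_Iic.1 hj
    have h0 : ∀ n, b.repr (v j n) i = 0 := fun n => (b.mem_span_image_Iio j _).1 (hv j n) i hji
    simp [g, hπ, hji, h0]
  have hle := hmin i z fun hmem => by
    have := (b.mem_span_image_Iio i _).1 hmem i le_rfl
    rw [hcoord] at this
    exact mul_ne_zero (hpos i).ne' (sub_ne_zero.2 hi') this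
  obtain ⟨m, hm, hm0⟩ : ∃ m ∈ Finset.Iic i, δ m ≠ 0 :=
    Finset.exists_ne_zero_of_sum_ne_zero (by rw [hsum]; exact (hpos i).ne')
  refine absurd hle (not_le.2 ?_)
  calc p (fun j => (z j : ℝ)) ≤ ∑ j ∈ Finset.Iic i, p (δ j • (g j x - g j y)) := by
        rw [← hz']
        exact Finset.le_sum_of_subadditive p (map_zero p).le (map_add_le_add p) _ _
    _ = ∑ j ∈ Finset.Iic i, δ j * p (g j x - g j y) := by
        refine Finset.sum_congr rfl fun j _ => ?_
        rw [map_smul_eq_mul, Real.norm_of_nonneg (hδ j)]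
    _ < ∑ j ∈ Finset.Iic i, δ j := by
        refine Finset.sum_lt_sum (fun j _ => ?_) ⟨m, hm, ?_⟩
        · exact mul_le_of_le_one_right (hδ j) (hdiam _ (hgS j x hx) _ (hgS j y hy)).le
        · exact mul_lt_of_lt_one_right ((hδ m).lt_of_ne' hm0)
            (hdiam _ (hgS m x hx) _ (hgS m y hy))
    _ = ν i := hsum i

/-- Greedy choice: in a `d`-dimensional space spanned by the points `e z`, one can pick `d`
linearly independent ones, each of minimal size outside the span of the previous ones. -/
theorem exists_greedy_linearIndependent {d : ℕ} {K V Z : Type*} [Nonempty Z] [Field K] [AddCommGroup V]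
    [Module K V] [FiniteDimensional K V] (hd : Module.finrank K V = d) (e : Z → V)
    (he : Submodule.span K (Set.range e) = ⊤) (N : Z → ℝ) (hN : ∀ R, {z | N z ≤ R}.Finite) :
    ∃ w : Fin d → Z, LinearIndependent K (fun i => e (w i)) ∧
      ∀ i, ∀ z, e z ∉ Submodule.span K ((fun j => e (w j)) '' Set.Iio i) → N (w i) ≤ N z := by
  have step : ∀ L : Submodule K V, L ≠ ⊤ → ∃ z, e z ∉ L ∧ ∀ z', e z' ∉ L → N z ≤ N z' := by
    intro L hL
    obtain ⟨z₀, hz₀⟩ : ∃ z, e z ∉ L := by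
      by_contra! h
      exact hL (top_le_iff.1 (he ▸ Submodule.span_le.2 (Set.range_subset_iff.2 h)))
    obtain ⟨z, hz, hmin⟩ := Set.exists_min_image {z | N z ≤ N z₀ ∧ e z ∉ L} N
      ((hN (N z₀)).subset fun _ h => h.1) ⟨z₀, le_rfl, hz₀⟩
    refine ⟨z, hz.2, fun z' hz' => ?_⟩
    rcases le_total (N z') (N z₀) with h | h
    · exact hmin z' ⟨h, hz'⟩
    · exact hz.1.trans h
  have : ∀ L : Submodule K V, ∃ z, L ≠ ⊤ → e z ∉ L ∧ ∀ z', e z' ∉ L → N z ≤ N z' := by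
    intro L
    by_cases hL : L = ⊤
    · exact ⟨Classical.arbitrary Z, fun h => absurd hL h⟩
    · exact (step L hL).imp fun _ h _ => h
  choose next hnext using this
  obtain ⟨L, hL0, hLsucc⟩ : ∃ L : ℕ → Submodule K V, L 0 = ⊥ ∧
      ∀ n, L (n + 1) = L n ⊔ Submodule.span K {e (next (L n))} :=
    ⟨fun n => Nat.rec ⊥ (fun _ M => M ⊔ Submodule.span K {e (next M)}) n, rfl, fun _ => rfl⟩
  let f : ℕ → Z := fun n => next (L n)
  have hL : ∀ n, L n = Submodule.span K ((fun m => e (f m)) '' Set.Iio n) := by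
    intro n
    induction n with
    | zero => simp [hL0]
    | succ n ih =>
      have hI : Set.Iio (n + 1) = insert n (Set.Iio n) := by ext; simp
      rw [hI, Set.image_insert_eq, Submodule.span_insert, ← ih, sup_comm, hLsucc]
  have hind : ∀ n, n ≤ d → LinearIndepOn K (fun m => e (f m)) (Set.Iio n) := by
    intro n
    induction n with
    | zero => intro _; simp
    | succ n ih =>
      intro hn
      have hI : Set.Iio (n + 1) = insert n (Set.Iio n) := by ext; simp
      rw [hI]
      refine (ih (by omega)).insert ?_
      rw [← hL]
      refine (hnext (L n) fun htop => ?_).1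
      classical
      have h1 : Module.finrank K (L n) ≤ n := by
        rw [hL, ← Finset.coe_Iio, ← Finset.coe_image]
        exact (finrank_span_finset_le_card _).trans (Finset.card_image_le.trans (by simp))
      rw [htop, finrank_top, hd] at h1
      omega
  have himg : ∀ i : Fin d, (fun j : Fin d => e (f j)) '' Set.Iio i =
      (fun m => e (f m)) '' Set.Iio (i : ℕ) := by
    intro i
    rw [← Fin.image_val_Iio, Set.image_image]
  refine ⟨fun i => f i, ?_, fun i z hz => ?_⟩
  · exact (hind d le_rfl).comp (fun i : Fin d => ⟨i, i.2⟩) fun i j h =>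
      Fin.ext (congrArg Subtype.val h)
  · rw [himg, ← hL] at hz
    exact (hnext (L i) fun htop => hz (htop ▸ Submodule.mem_top)).2 z hz

theorem span_range_intCast_eq_top (d : ℕ) :
    Submodule.span ℝ (Set.range fun (z : Fin d → ℤ) (j : Fin d) => (z j : ℝ)) = ⊤ := by
  rw [eq_top_iff, ← (Pi.basisFun ℝ (Fin d)).span_eq, Submodule.span_le]
  rintro _ ⟨i, rfl⟩
  refine Submodule.subset_span ⟨Pi.single i 1, ?_⟩
  ext j
  by_cases h : j = i
  · subst h
    simp
  · simp [h]

theorem finite_setOf_norm_apply_intCast_le {d : ℕ} {F : Type*} [NormedAddCommGroup F]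
    [NormedSpace ℝ F] (B : (Fin d → ℝ) ≃ₗ[ℝ] F) (R : ℝ) :
    {z : Fin d → ℤ | ‖B fun j => (z j : ℝ)‖ ≤ R}.Finite := by
  have : FiniteDimensional ℝ F := B.finiteDimensional
  let C := LinearMap.toContinuousLinearMap (B.symm : F →ₗ[ℝ] Fin d → ℝ)
  refine (Set.finite_Icc (fun _ => -⌈‖C‖ * R⌉) (fun _ => ⌈‖C‖ * R⌉)).subset fun z hz => ?_
  have h1 : ‖fun j => (z j : ℝ)‖ ≤ ‖C‖ * R := by
    calc ‖fun j => (z j : ℝ)‖ = ‖C (B fun j => (z j : ℝ))‖ := by simp [C]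
      _ ≤ ‖C‖ * ‖B fun j => (z j : ℝ)‖ := C.le_opNorm _
      _ ≤ ‖C‖ * R := by gcongr; exact hz
  have h2 : ∀ j, |z j| ≤ ⌈‖C‖ * R⌉ := by
    intro j
    have := ((norm_le_pi_norm (fun j => (z j : ℝ)) j).trans h1).trans (Int.le_ceil _)
    rw [Real.norm_eq_abs] at this
    exact_mod_cast this
  exact ⟨fun j => (abs_le.1 (h2 j)).1, fun j => (abs_le.1 (h2 j)).2⟩

theorem setOf_forall_abs_le_one_eq_closedBall (d : ℕ) :
    {x : Fin d → ℝ | ∀ i, |x i| ≤ 1} = Metric.closedBall 0 1 := by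
  ext x
  simp [pi_norm_le_iff_of_nonneg zero_le_one]

theorem mem_smul_image_closedBall_iff {d : ℕ} (A : (Fin d → ℝ) ≃ₗ[ℝ] (Fin d → ℝ)) {μ : ℝ}
    (hμ : 0 < μ) (x : Fin d → ℝ) :
    x ∈ μ • (A '' Metric.closedBall 0 1) ↔ ‖A.symm x‖ ≤ μ := by
  rw [Set.mem_smul_set_iff_inv_smul_mem₀ hμ.ne', LinearEquiv.image_eq_preimage_symm]
  simp [norm_smul, abs_of_pos hμ, inv_mul_le_iff₀ hμ]

theorem succMin_image_closedBall_eq {d : ℕ} (A : (Fin d → ℝ) ≃ₗ[ℝ] (Fin d → ℝ))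
    (w : Fin d → Fin d → ℤ) (hw : LinearIndependent ℝ fun i j => (w i j : ℝ))
    (hmono : Monotone fun i => ‖A.symm fun j => (w i j : ℝ)‖)
    (hmin : ∀ i, ∀ z : Fin d → ℤ,
      (fun j => (z j : ℝ)) ∉ Submodule.span ℝ ((fun i j => (w i j : ℝ)) '' Set.Iio i) →
      ‖A.symm fun j => (w i j : ℝ)‖ ≤ ‖A.symm fun j => (z j : ℝ)‖) (i : Fin d) :
    succMin (i + 1) (A '' Metric.closedBall 0 1) = ‖A.symm fun j => (w i j : ℝ)‖ := by
  have hpos : 0 < ‖A.symm fun j => (w i j : ℝ)‖ :=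
    norm_pos_iff.2 (A.symm.map_ne_zero_iff.2 (hw.ne_zero i))
  refine IsLeast.csInf_eq ⟨⟨hpos, fun j => w (Fin.castLE i.2 j), ?_, fun j => ?_⟩, ?_⟩
  · exact hw.comp _ (Fin.castLE_injective _)
  · exact (mem_smul_image_closedBall_iff A hpos _).2
      (hmono (Fin.le_def.2 (Nat.lt_succ_iff.1 j.2)))
  · rintro μ ⟨hμ, u, hu, humem⟩
    obtain ⟨j, hj⟩ : ∃ j, (fun l => (u j l : ℝ)) ∉
        Submodule.span ℝ ((fun i j => (w i j : ℝ)) '' Set.Iio i) := by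
      by_contra! h
      have h1 := Submodule.finrank_mono (Submodule.span_le.2 (Set.range_subset_iff.2 h))
      rw [finrank_span_eq_card hu, Fintype.card_fin, ← Finset.coe_Iio, ← Finset.coe_image] at h1
      have h2 := h1.trans ((finrank_span_finset_le_card _).trans Finset.card_image_le)
      simp at h2
    exact (hmin i (u j) hj).trans ((mem_smul_image_closedBall_iff A hμ _).1 (humem j))

/-- Every term of the Leibniz expansion is bounded by the product of the row bounds. -/
theorem Matrix.abs_det_le_factorial_mul_prod {d : ℕ} (M : Matrix (Fin d) (Fin d) ℝ)
    {r : Fin d → ℝ} (h : ∀ i j, |M i j| ≤ r i) : |M.det| ≤ d.factorial * ∏ i, r i := by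
  rw [Matrix.det_apply']
  calc |∑ σ : Equiv.Perm (Fin d), ((Equiv.Perm.sign σ : ℤ) : ℝ) * ∏ i, M (σ i) i|
      ≤ ∑ σ : Equiv.Perm (Fin d), |((Equiv.Perm.sign σ : ℤ) : ℝ) * ∏ i, M (σ i) i| :=
        Finset.abs_sum_le_sum_abs _ _
    _ ≤ ∑ _σ : Equiv.Perm (Fin d), ∏ i, r i := by
        refine Finset.sum_le_sum fun σ _ => ?_
        have hs : |((Equiv.Perm.sign σ : ℤ) : ℝ)| = 1 := by
          rcases Int.units_eq_one_or (Equiv.Perm.sign σ) with h | h <;> simp [h]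
        rw [abs_mul, hs, one_mul, Finset.abs_prod, ← Equiv.prod_comp σ r]
        exact Finset.prod_le_prod (fun _ _ => abs_nonneg _) fun i _ => h _ _
    _ = d.factorial * ∏ i, r i := by
        rw [Finset.sum_const, Finset.card_univ, Fintype.card_perm, Fintype.card_fin, nsmul_eq_mul]

/-- The lower bound in Minkowski's second theorem for a parallelepiped. -/
theorem one_le_abs_det_mul_factorial_mul_prod {d : ℕ} (A : (Fin d → ℝ) ≃ₗ[ℝ] (Fin d → ℝ))
    (w : Fin d → Fin d → ℤ) (hw : LinearIndependent ℝ fun i j => (w i j : ℝ)) :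
    1 ≤ |LinearMap.det (A : (Fin d → ℝ) →ₗ[ℝ] (Fin d → ℝ))| *
      (d.factorial * ∏ i, ‖A.symm fun j => (w i j : ℝ)‖) := by
  let W : Matrix (Fin d) (Fin d) ℤ := Matrix.of w
  let Y : Matrix (Fin d) (Fin d) ℝ := Matrix.of fun i => A.symm fun j => (w i j : ℝ)
  have hWdet : W.det ≠ 0 := by
    have h : IsUnit (W.map (Int.castRingHom ℝ)) := Matrix.linearIndependent_rows_iff_isUnit.1 hw
    rw [Matrix.isUnit_iff_isUnit_det, ← RingHom.mapMatrix_apply, ← RingHom.map_det] at h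
    intro h0
    simp [h0] at h
  have hWY : W.map (Int.castRingHom ℝ) =
      Y * (LinearMap.toMatrix' (A : (Fin d → ℝ) →ₗ[ℝ] (Fin d → ℝ))).transpose := by
    ext i j
    have h := congrFun (LinearMap.toMatrix'_mulVec (A : (Fin d → ℝ) →ₗ[ℝ] (Fin d → ℝ)) (Y i)) j
    have hA : A (Y i) j = w i j := congrFun (A.apply_symm_apply _) j
    rw [LinearEquiv.coe_coe, hA] at h
    rw [Matrix.mul_apply]
    simp only [Matrix.mulVec, dotProduct] at h
    simp only [Matrix.transpose_apply, mul_comm (Y i _), h]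
    simp [W]
  have hdet : (W.det : ℝ) = Y.det * LinearMap.det (A : (Fin d → ℝ) →ₗ[ℝ] (Fin d → ℝ)) := by
    rw [← LinearMap.det_toMatrix', ← Matrix.det_transpose (LinearMap.toMatrix' _),
      ← Matrix.det_mul, ← hWY, ← RingHom.mapMatrix_apply, ← RingHom.map_det]
    simp
  calc (1 : ℝ) ≤ |(W.det : ℝ)| := by exact_mod_cast Int.one_le_abs hWdet
    _ = |LinearMap.det (A : (Fin d → ℝ) →ₗ[ℝ] (Fin d → ℝ))| * |Y.det| := by
        rw [hdet, abs_mul, mul_comm]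
    _ ≤ _ := by
        gcongr
        exact Y.abs_det_le_factorial_mul_prod fun i j => norm_le_pi_norm (Y i) j

/-- Minkowski's second theorem for a `0`-symmetric parallelepiped `Π ⊆ ℝ^d`:
`2^d/(d!·vol Π) ≤ μ₁(Π,ℤ^d) ⋯ μ_d(Π,ℤ^d) ≤ 2^d/vol Π`. -/
theorem stmt_9 (d : ℕ) (hd : 1 ≤ d) (A : (Fin d → ℝ) ≃ₗ[ℝ] (Fin d → ℝ)) :
    2 ^ d / (d.factorial * (volume (A '' {x : Fin d → ℝ | ∀ i, |x i| ≤ 1})).toReal)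
        ≤ ∏ i : Fin d, succMin (i + 1) (A '' {x : Fin d → ℝ | ∀ i, |x i| ≤ 1}) ∧
      ∏ i : Fin d, succMin (i + 1) (A '' {x : Fin d → ℝ | ∀ i, |x i| ≤ 1})
        ≤ 2 ^ d / (volume (A '' {x : Fin d → ℝ | ∀ i, |x i| ≤ 1})).toReal := by
  rw [setOf_forall_abs_le_one_eq_closedBall]
  obtain ⟨w, hw, hmin⟩ := exists_greedy_linearIndependent (Module.finrank_fin_fun ℝ)
    (fun (z : Fin d → ℤ) (j : Fin d) => (z j : ℝ)) (span_range_intCast_eq_top d)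
    (fun z => ‖A.symm fun j => (z j : ℝ)‖) (finite_setOf_norm_apply_intCast_le A.symm)
  let ν : Fin d → ℝ := fun i => ‖A.symm fun j => (w i j : ℝ)‖
  have hpos : ∀ i, 0 < ν i := fun i =>
    norm_pos_iff.2 (A.symm.map_ne_zero_iff.2 (hw.ne_zero i))
  have hmono : Monotone ν := fun i j hij =>
    hmin i (w j) (hw.notMem_span_image (by simpa using hij))
  have : Nonempty (Fin d) := ⟨⟨0, hd⟩⟩
  let b := basisOfLinearIndependentOfCardEqFinrank hw (by simp)
  have hb : ⇑b = fun i j => (w i j : ℝ) := coe_basisOfLinearIndependentOfCardEqFinrank _ _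
  let D : ℝ := |LinearMap.det (A : (Fin d → ℝ) →ₗ[ℝ] (Fin d → ℝ))|
  have hD : 0 < D := abs_pos.2 A.isUnit_det'.ne_zero
  have hvol : (volume (A '' Metric.closedBall (0 : Fin d → ℝ) 1)).toReal = D * 2 ^ d := by
    have h := Measure.addHaar_image_linearMap volume (A : (Fin d → ℝ) →ₗ[ℝ] (Fin d → ℝ))
      (Metric.closedBall 0 1)
    rw [Real.volume_pi_closedBall _ zero_le_one, ← ENNReal.ofReal_mul hD.le] at h
    rw [LinearEquiv.coe_coe] at h
    rw [h, ENNReal.toReal_ofReal (by positivity)]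
    simp [D]
  have hupper : (∏ i, ν i) * D ≤ 1 := by
    have h := ofReal_prod_mul_volume_le_one
      ((normSeminorm ℝ (Fin d → ℝ)).comp (A.symm : (Fin d → ℝ) →ₗ[ℝ] (Fin d → ℝ))) b hmono hpos
      (fun i z hz => hmin i z (by rwa [hb] at hz)) (S := A '' Metric.ball 0 (1 / 2))
      (A.toContinuousLinearEquiv.toHomeomorph.isOpenMap _ Metric.isOpen_ball) ?_
    · have hball := Measure.addHaar_image_linearMap volume (A : (Fin d → ℝ) →ₗ[ℝ] (Fin d → ℝ))
        (Metric.ball 0 (1 / 2))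
      rw [Real.volume_pi_ball _ one_half_pos, ← ENNReal.ofReal_mul hD.le,
        LinearEquiv.coe_coe] at hball
      rw [hball, ← ENNReal.ofReal_mul (Finset.prod_nonneg fun i _ => (hpos i).le),
        ENNReal.ofReal_le_one] at h
      simpa [D] using h
    · rintro _ ⟨x, hx, rfl⟩ _ ⟨y, hy, rfl⟩
      rw [mem_ball_zero_iff] at hx hy
      have : ‖x - y‖ < 1 := (norm_sub_le x y).trans_lt (by linarith)
      simpa using this
  have hlower : 1 ≤ D * (d.factorial * ∏ i, ν i) := one_le_abs_det_mul_factorial_mul_prod A w hw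
  rw [hvol, Finset.prod_congr rfl fun i _ => succMin_image_closedBall_eq A w hw hmono hmin i]
  constructor
  · rw [div_le_iff₀ (by positivity)]
    have := mul_le_mul_of_nonneg_right hlower (by positivity : (0 : ℝ) ≤ 2 ^ d)
    linarith
  · rw [le_div_iff₀ (by positivity), ← mul_assoc]
    exact mul_le_of_le_one_left (by positivity) hupper
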